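/- For any ultrafilters U and V on ω: U·V·V ≡_T U × (V·V), and consequently (U·U)·(V·V) ≡_T (V·V)·(U·U). -/

import Mathlib

open Set

/-- A subset `S` is bounded with respect to the relation `r`. -/
def RelBounded {α : Type*} (r : α → α → Prop) (S : Set α) : Prop :=
  ∃ b, ∀ a ∈ S, r a b

/-- Tukey reducibility between two ordered sets: there is a map sending every
unbounded set to an unbounded set. -/
def TukeyLE {α β : Type*} (ra : α → α → Prop) (rb : β → β → Prop) : Prop :=
  ∃ f : α → β, ∀ S : Set α, ¬ RelBounded ra S → ¬ RelBounded rb (f '' S)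

/-- Tukey equivalence. -/
def TukeyEquiv {α β : Type*} (ra : α → α → Prop) (rb : β → β → Prop) : Prop :=
  TukeyLE ra rb ∧ TukeyLE rb ra

/-- `S` is cofinal with respect to the relation `r`. -/
def IsCofinalIn {α : Type*} (r : α → α → Prop) (S : Set α) : Prop :=
  ∀ a, ∃ b ∈ S, r a b

/-- The poset `(U, ⊇)` associated to a filter `U`: `A ≤ B` iff `A ⊇ B`. -/
def filtRel {X : Type*} (U : Filter X) :
    {A : Set X // A ∈ U} → {A : Set X // A ∈ U} → Prop :=
  fun A B => B.1 ⊆ A.1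

/-- The poset `(I, ⊆)` associated to a family of sets `I`. -/
def subRel {X : Type*} (I : Set (Set X)) :
    {A : Set X // A ∈ I} → {A : Set X // A ∈ I} → Prop :=
  fun A B => A.1 ⊆ B.1

/-- The Fubini product of filters: `A ∈ U·V` iff `{x | (A)_x ∈ V} ∈ U`,
where `(A)_x = {y | (x, y) ∈ A}`. -/
def fubini {X Y : Type*} (U : Filter X) (V : Filter Y) : Filter (X × Y) :=
  U.bind fun x => V.map (Prod.mk x)

/-- The ω-fold power of an ordered set, with the everywhere (pointwise)
domination order. -/
def seqRel {α : Type*} (r : α → α → Prop) : (ℕ → α) → (ℕ → α) → Prop :=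
  fun f g => ∀ n, r (f n) (g n)

/-- The product order on a Cartesian product of two ordered sets. -/
def prodRel {α β : Type*} (ra : α → α → Prop) (rb : β → β → Prop) :
    α × β → α × β → Prop :=
  fun p q => ra p.1 q.1 ∧ rb p.2 q.2

/-- The everywhere domination order on `ω^ω`. -/
def domRel : (ℕ → ℕ) → (ℕ → ℕ) → Prop := fun f g => ∀ n, f n ≤ g n

/-- An ideal on `X`: a family of subsets containing `∅`, closed under subsets
and finite unions. -/
def IsIdeal {X : Type*} (I : Set (Set X)) : Prop :=
  ∅ ∈ I ∧ (∀ A ∈ I, ∀ B ⊆ A, B ∈ I) ∧ (∀ A ∈ I, ∀ B ∈ I, A ∪ B ∈ I)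

/-- `U` has the `I`-pseudo-intersection property: every ω-sequence of members of `U`
has a pseudo-intersection modulo `I` in `U`. -/
def HasPIP {X : Type*} (U : Filter X) (I : Set (Set X)) : Prop :=
  ∀ A : ℕ → Set X, (∀ n, A n ∈ U) → ∃ B ∈ U, ∀ n, B \ A n ∈ I

/-- A p-point: a nonprincipal ultrafilter on `ω` which has the fin-pseudo-intersection
property. -/
def IsPPoint (U : Ultrafilter ℕ) : Prop :=
  (∀ a : ℕ, (U : Filter ℕ) ≠ pure a) ∧
  ∀ A : ℕ → Set ℕ, (∀ n, A n ∈ U) → ∃ B ∈ U, ∀ n, (B \ A n).Finite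

/-- A rapid ultrafilter: a nonprincipal ultrafilter `U` on `ω` such that for every
increasing `f : ω → ω` there is `X ∈ U` with `|X ∩ f(n)| ≤ n` for all `n`. -/
def IsRapid (U : Ultrafilter ℕ) : Prop :=
  (∀ a : ℕ, (U : Filter ℕ) ≠ pure a) ∧
  ∀ f : ℕ → ℕ, StrictMono f → ∃ X ∈ U, ∀ n, (X ∩ Set.Iio (f n)).ncard ≤ n

/-- The ideal `fin ⊗ fin` on `ω × ω`: all sets with only finitely many infinite
vertical sections. -/
def finOtimesFin : Set (Set (ℕ × ℕ)) :=
  {A | {n : ℕ | {m : ℕ | (n, m) ∈ A}.Infinite}.Finite}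

/-- The power of an ordered set by an index type, ordered pointwise. -/
def powRel {α : Type*} (ι : Type*) (r : α → α → Prop) : (ι → α) → (ι → α) → Prop :=
  fun f g => ∀ i, r (f i) (g i)

section Tukey

variable {α β γ δ : Type*} {ra : α → α → Prop} {rb : β → β → Prop} {rc : γ → γ → Prop}
  {rd : δ → δ → Prop}

theorem TukeyLE.of_bounded (f : α → β)
    (h : ∀ S b, (∀ a ∈ S, rb (f a) b) → RelBounded ra S) : TukeyLE ra rb := by
  refine ⟨f, fun S hS ⟨b, hb⟩ => hS (h S b fun a ha => hb _ (mem_image_of_mem f ha))⟩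

theorem TukeyLE.of_connection (f : α → β) (g : β → α)
    (h : ∀ a b, rb (f a) b → ra a (g b)) : TukeyLE ra rb :=
  .of_bounded f fun _ b hb => ⟨g b, fun a ha => h a b (hb a ha)⟩

theorem TukeyLE.exists_map (h : TukeyLE ra rb) :
    ∃ f : α → β, ∀ S b, (∀ a ∈ S, rb (f a) b) → RelBounded ra S := by
  obtain ⟨f, hf⟩ := h
  refine ⟨f, fun S b hb => by_contra fun hS => hf S hS ⟨b, ?_⟩⟩
  rintro _ ⟨a, ha, rfl⟩
  exact hb a ha

theorem TukeyLE.refl (ra : α → α → Prop) : TukeyLE ra ra :=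
  .of_connection id id fun _ _ => id

theorem TukeyLE.trans (h₁ : TukeyLE ra rb) (h₂ : TukeyLE rb rc) : TukeyLE ra rc := by
  obtain ⟨f, hf⟩ := h₁
  obtain ⟨g, hg⟩ := h₂
  refine ⟨g ∘ f, fun S hS => ?_⟩
  rw [image_comp]
  exact hg _ (hf S hS)

theorem TukeyLE.prod (h₁ : TukeyLE ra rc) (h₂ : TukeyLE rb rd) :
    TukeyLE (prodRel ra rb) (prodRel rc rd) := by
  obtain ⟨f, hf⟩ := h₁.exists_map
  obtain ⟨g, hg⟩ := h₂.exists_map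
  refine .of_bounded (Prod.map f g) fun S b hb => ?_
  obtain ⟨x, hx⟩ := hf (Prod.fst '' S) b.1 (forall_mem_image.2 fun a ha => (hb a ha).1)
  obtain ⟨y, hy⟩ := hg (Prod.snd '' S) b.2 (forall_mem_image.2 fun a ha => (hb a ha).2)
  exact ⟨(x, y), fun a ha => ⟨hx _ (mem_image_of_mem _ ha), hy _ (mem_image_of_mem _ ha)⟩⟩

theorem TukeyLE.pow (ι : Type*) (h : TukeyLE ra rb) : TukeyLE (powRel ι ra) (powRel ι rb) := by
  obtain ⟨f, hf⟩ := h.exists_map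
  refine .of_bounded (fun a i => f (a i)) fun S b hb => ?_
  choose x hx using fun i => hf ((fun a : ι → α => a i) '' S) (b i)
    (forall_mem_image.2 fun a ha => hb a ha i)
  exact ⟨x, fun a ha i => hx i _ (mem_image_of_mem _ ha)⟩

theorem tukeyLE_prod_swap (ra : α → α → Prop) (rb : β → β → Prop) :
    TukeyLE (prodRel ra rb) (prodRel rb ra) :=
  .of_connection Prod.swap Prod.swap fun _ _ h => ⟨h.2, h.1⟩

theorem tukeyLE_prod_assoc (ra : α → α → Prop) (rb : β → β → Prop) (rc : γ → γ → Prop) :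
    TukeyLE (prodRel (prodRel ra rb) rc) (prodRel ra (prodRel rb rc)) :=
  .of_connection (fun p => (p.1.1, p.1.2, p.2)) (fun p => ((p.1, p.2.1), p.2.2))
    fun _ _ h => ⟨⟨h.1, h.2.1⟩, h.2.2⟩

theorem tukeyLE_prod_pow_pow (ι κ : Type*) (ra : α → α → Prop) :
    TukeyLE (prodRel (powRel ι ra) (powRel κ ra)) (powRel (ι ⊕ κ) ra) :=
  .of_connection (fun p => Sum.elim p.1 p.2) (fun q => (q ∘ Sum.inl, q ∘ Sum.inr))
    fun _ _ h => ⟨fun i => h (.inl i), fun k => h (.inr k)⟩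

theorem tukeyLE_pow_pow (ι κ : Type*) (ra : α → α → Prop) :
    TukeyLE (powRel ι (powRel κ ra)) (powRel (ι × κ) ra) :=
  .of_connection (fun p x => p x.1 x.2) (fun q i k => q (i, k)) fun _ _ h i k => h (i, k)

theorem tukeyLE_pow_unit (ra : α → α → Prop) : TukeyLE ra (powRel Unit ra) :=
  .of_connection (fun a _ => a) (fun q => q ()) fun _ _ h => h ()

end Tukey

section Fubini

variable {X Y : Type*}

theorem mem_fubini {U : Filter X} {V : Filter Y} {A : Set (X × Y)} :
    A ∈ fubini U V ↔ {x | {y | (x, y) ∈ A} ∈ V} ∈ U :=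
  Iff.rfl

theorem tukeyLE_fubini_prod_pow (U : Filter X) (V : Filter Y) :
    TukeyLE (filtRel (fubini U V)) (prodRel (filtRel U) (powRel X (filtRel V))) := by
  classical
  refine .of_connection
    (fun A => (⟨_, mem_fubini.1 A.2⟩, fun x =>
      if h : {y | (x, y) ∈ A.1} ∈ V then ⟨_, h⟩ else ⟨univ, Filter.univ_mem⟩))
    (fun B => ⟨{p | p.1 ∈ B.1.1 ∧ p.2 ∈ (B.2 p.1).1}, mem_fubini.2 ?_⟩) ?_
  · filter_upwards [B.1.2] with x hx
    filter_upwards [(B.2 x).2] with y hy using ⟨hx, hy⟩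
  · rintro A B ⟨h₁, h₂⟩ ⟨x, y⟩ ⟨hx, hy⟩
    have hA : {y | (x, y) ∈ A.1} ∈ V := h₁ hx
    have := h₂ x hy
    simp only [dif_pos hA] at this
    exact this

theorem tukeyLE_prod_fubini (U : Filter X) (V : Filter Y) [U.NeBot] [V.NeBot] :
    TukeyLE (prodRel (filtRel U) (filtRel V)) (filtRel (fubini U V)) := by
  have key (C : {A // A ∈ fubini U V}) : ∃ x, {y | (x, y) ∈ C.1} ∈ V :=
    Filter.nonempty_of_mem (mem_fubini.1 C.2)
  choose x hx using key
  refine .of_connection (fun p => ⟨p.1.1 ×ˢ p.2.1, mem_fubini.2 ?_⟩)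
    (fun C => (⟨_, mem_fubini.1 C.2⟩, ⟨_, hx C⟩)) ?_
  · filter_upwards [p.1.2] with a ha
    filter_upwards [p.2.2] with b hb using ⟨ha, hb⟩
  · intro p C h
    refine ⟨fun a ha => ?_, fun b hb => (h hb).2⟩
    obtain ⟨b, hb⟩ := Filter.nonempty_of_mem (f := V) ha
    exact (h hb).1

theorem tukeyLE_prod_fubini_fubini {Z : Type*} (U : Filter X) (V : Filter Y) (W : Filter Z)
    [U.NeBot] [V.NeBot] [W.NeBot] :
    TukeyLE (prodRel (filtRel U) (filtRel (fubini V W))) (filtRel (fubini (fubini U V) W)) := by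
  have key (C : {A // A ∈ fubini (fubini U V) W}) :
      ∃ x, {y | {z | ((x, y), z) ∈ C.1} ∈ W} ∈ V :=
    Filter.nonempty_of_mem (mem_fubini.1 (mem_fubini.1 C.2))
  choose x hx using key
  refine .of_connection
    (fun p => ⟨{q | q.1.1 ∈ p.1.1 ∧ (q.1.2, q.2) ∈ p.2.1}, mem_fubini.2 (mem_fubini.2 ?_)⟩)
    (fun C => (⟨_, mem_fubini.1 (mem_fubini.1 C.2)⟩,
      ⟨{q | ((x C, q.1), q.2) ∈ C.1}, mem_fubini.2 (hx C)⟩)) ?_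
  · filter_upwards [p.1.2] with a ha
    filter_upwards [mem_fubini.1 p.2.2] with b hb
    filter_upwards [hb] with c hc using ⟨ha, hc⟩
  · intro p C h
    refine ⟨fun a ha => ?_, fun b hb => (h hb).2⟩
    obtain ⟨b, hb⟩ := Filter.nonempty_of_mem (f := V) ha
    obtain ⟨c, hc⟩ := Filter.nonempty_of_mem (f := W) hb
    exact (h hc).1

theorem tukeyLE_pow_fubini_self (V : Ultrafilter ℕ) (ι : Type*) [Countable ι] :
    TukeyLE (powRel ι (filtRel (V : Filter ℕ)))
      (filtRel (fubini (V : Filter ℕ) (V : Filter ℕ))) := by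
  rcases V.le_cofinite_or_eq_pure with hV | ⟨v, rfl⟩
  · obtain ⟨e, he⟩ := exists_injective_nat ι
    have key (B : {A // A ∈ fubini (V : Filter ℕ) (V : Filter ℕ)}) (i : ι) :
        ∃ n, e i ≤ n ∧ {m | (n, m) ∈ B.1} ∈ (V : Filter ℕ) := by
      have : Ici (e i) ∈ (V : Filter ℕ) :=
        hV (Nat.cofinite_eq_atTop ▸ Filter.Ici_mem_atTop (e i))
      exact Filter.nonempty_of_mem (Filter.inter_mem this (mem_fubini.1 B.2))
    choose n hn hB using key
    refine .of_connection
      (fun A => ⟨{p | ∀ i ∈ e ⁻¹' Iic p.1, p.2 ∈ (A i).1}, mem_fubini.2 ?_⟩)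
      (fun B i => ⟨_, hB B i⟩) fun A B h i m hm => h hm i (hn B i)
    refine Filter.Eventually.of_forall fun k => ?_
    exact (Filter.eventually_all_finite ((finite_Iic k).preimage he.injOn)).2
      fun i _ => (A i).2
  · refine .of_connection (fun _ => ⟨univ, Filter.univ_mem⟩)
      (fun _ _ => ⟨{v}, by simp⟩) fun A _ _ i => ?_
    exact singleton_subset_iff.2 (A i).2

theorem tukeyLE_pow_fubini (V : Ultrafilter ℕ) (ι : Type*) [Countable ι] :
    TukeyLE (powRel ι (filtRel (fubini (V : Filter ℕ) (V : Filter ℕ))))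
      (filtRel (fubini (V : Filter ℕ) (V : Filter ℕ))) :=
  (((tukeyLE_fubini_prod_pow _ _).trans <|
    ((tukeyLE_pow_unit _).prod (.refl _)).trans (tukeyLE_prod_pow_pow _ _ _)).pow ι).trans <|
      (tukeyLE_pow_pow _ _ _).trans (tukeyLE_pow_fubini_self V _)

theorem tukeyLE_fubini_fubini_prod (U V : Ultrafilter ℕ) :
    TukeyLE (filtRel (fubini (fubini (U : Filter ℕ) (V : Filter ℕ)) (V : Filter ℕ)))
      (prodRel (filtRel (U : Filter ℕ)) (filtRel (fubini (V : Filter ℕ) (V : Filter ℕ)))) :=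
  (tukeyLE_fubini_prod_pow _ _).trans <|
    ((tukeyLE_fubini_prod_pow _ _).prod (.refl _)).trans <|
      (tukeyLE_prod_assoc _ _ _).trans <|
        (TukeyLE.refl _).prod <| (tukeyLE_prod_pow_pow _ _ _).trans (tukeyLE_pow_fubini_self V _)

instance fubini_neBot (U : Filter X) (V : Filter Y) [U.NeBot] [V.NeBot] :
    (fubini U V).NeBot :=
  ⟨fun h => by
    have : (∅ : Set (X × Y)) ∈ fubini U V := h ▸ Filter.mem_bot
    obtain ⟨x, hx⟩ := Filter.nonempty_of_mem (mem_fubini.1 this)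
    exact (Filter.nonempty_of_mem (f := V) hx).elim fun _ => id⟩

theorem tukeyLE_fubini_self_comm (U V : Ultrafilter ℕ) :
    TukeyLE
      (filtRel (fubini (fubini (U : Filter ℕ) (U : Filter ℕ))
        (fubini (V : Filter ℕ) (V : Filter ℕ))))
      (filtRel (fubini (fubini (V : Filter ℕ) (V : Filter ℕ))
        (fubini (U : Filter ℕ) (U : Filter ℕ)))) :=
  (tukeyLE_fubini_prod_pow _ _).trans <|
    ((TukeyLE.refl _).prod (tukeyLE_pow_fubini V _)).trans <|
      (tukeyLE_prod_swap _ _).trans (tukeyLE_prod_fubini _ _)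

end Fubini

/-- For ultrafilters `U, V` on `ω`: `U·V·V ≡_T U × (V·V)`, and
consequently `(U·U)·(V·V) ≡_T (V·V)·(U·U)`. -/
theorem stmt2 (U V : Ultrafilter ℕ) :
    TukeyEquiv (filtRel (fubini (fubini (U : Filter ℕ) (V : Filter ℕ)) (V : Filter ℕ)))
      (prodRel (filtRel (U : Filter ℕ)) (filtRel (fubini (V : Filter ℕ) (V : Filter ℕ)))) ∧
    TukeyEquiv
      (filtRel (fubini (fubini (U : Filter ℕ) (U : Filter ℕ))
        (fubini (V : Filter ℕ) (V : Filter ℕ))))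
      (filtRel (fubini (fubini (V : Filter ℕ) (V : Filter ℕ))
        (fubini (U : Filter ℕ) (U : Filter ℕ)))) := by
  exact ⟨⟨tukeyLE_fubini_fubini_prod U V, tukeyLE_prod_fubini_fubini _ _ _⟩,
    tukeyLE_fubini_self_comm U V, tukeyLE_fubini_self_comm V U⟩
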